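/- Let λ, p, q, A ∈ ℝ with A ≠ 0, let h > 0 with A·h ≠ 0, let M be a positive integer, let ξ : ℕ → ℝ, and let x, x' ∈ ℝ. Define y, y' : ℕ → ℝ by y(m+1) = y(m) + h·(q·x − A·y(m)) + √h·ξ(m) and y'(m+1) = y'(m) + h·(q·x' − A·y'(m)) + √h·ξ(m) for m ≥ 1, with y'(1) = y(1). Then (1/M)·Σ_{m=1}^{M} (λx' + p·y'(m)) − (1/M)·Σ_{m=1}^{M} (λx + p·y(m)) = (λ + (pq/A)·(1 − B̃))·(x' − x), where B̃ = (1 − (1 − A·h)^M)/(M·A·h). -/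

import Mathlib

/-- The gap between two Euler–Maruyama chains for the fast equation driven by the same noise
and started at the same point. -/
lemma eulerMaruyama_gap {q A h x x' : ℝ} {ξ y y' : ℕ → ℝ}
    (hy : ∀ m : ℕ, 1 ≤ m → y (m + 1) = y m + h * (q * x - A * y m) + Real.sqrt h * ξ m)
    (hy' : ∀ m : ℕ, 1 ≤ m → y' (m + 1) = y' m + h * (q * x' - A * y' m) + Real.sqrt h * ξ m)
    (hinit : y' 1 = y 1) (k : ℕ) :
    A * (y' (k + 1) - y (k + 1)) = q * (x' - x) * (1 - (1 - A * h) ^ k) := by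
  induction k with
  | zero => simp [hinit]
  | succ k ih =>
    rw [hy (k + 1) (by omega), hy' (k + 1) (by omega), pow_succ]
    linear_combination (1 - A * h) * ih

/-- The summed gap between two Euler–Maruyama chains for the fast equation driven by the same
noise and started at the same point. -/
lemma sum_eulerMaruyama_gap {q A h x x' : ℝ} {ξ y y' : ℕ → ℝ}
    (hy : ∀ m : ℕ, 1 ≤ m → y (m + 1) = y m + h * (q * x - A * y m) + Real.sqrt h * ξ m)
    (hy' : ∀ m : ℕ, 1 ≤ m → y' (m + 1) = y' m + h * (q * x' - A * y' m) + Real.sqrt h * ξ m)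
    (hinit : y' 1 = y 1) (n : ℕ) :
    A * (A * h) * (∑ m ∈ Finset.Icc 1 n, y' m - ∑ m ∈ Finset.Icc 1 n, y m)
      = q * (x' - x) * (n * (A * h) - (1 - (1 - A * h) ^ n)) := by
  induction n with
  | zero => simp
  | succ n ih =>
    rw [Finset.sum_Icc_succ_top (by omega), Finset.sum_Icc_succ_top (by omega), pow_succ]
    push_cast
    linear_combination ih + A * h * eulerMaruyama_gap hy hy' hinit n

/-- The difference of two HMM estimators of the averaged drift of the linear slow-fast
system, computed at consecutive slow values `x, x'` from Euler–Maruyama chains driven by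
the same noise, equals `(λ + (pq/A)·(1 − B̃))·(x' − x)` with
`B̃ = (1 − (1 − A·h)^M)/(M·A·h)`. -/
theorem HMM_estimator_difference (lam p q A : ℝ) (hA : A ≠ 0) (h : ℝ) (hh : 0 < h)
    (hAh : A * h ≠ 0) (M : ℕ) (hM : 0 < M) (ξ : ℕ → ℝ) (x x' : ℝ) (y y' : ℕ → ℝ)
    (hy : ∀ m : ℕ, 1 ≤ m → y (m + 1) = y m + h * (q * x - A * y m) + Real.sqrt h * ξ m)
    (hy' : ∀ m : ℕ, 1 ≤ m → y' (m + 1) = y' m + h * (q * x' - A * y' m) + Real.sqrt h * ξ m)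
    (hinit : y' 1 = y 1) :
    (1 / (M : ℝ)) * ∑ m ∈ Finset.Icc 1 M, (lam * x' + p * y' m)
      - (1 / (M : ℝ)) * ∑ m ∈ Finset.Icc 1 M, (lam * x + p * y m)
      = (lam + (p * q / A) * (1 - (1 - (1 - A * h) ^ M) / (M * (A * h)))) * (x' - x) := by
  have hM' : (M : ℝ) ≠ 0 := by exact_mod_cast hM.ne'
  have hS := sum_eulerMaruyama_gap hy hy' hinit M
  have hgap : ∑ m ∈ Finset.Icc 1 M, y' m - ∑ m ∈ Finset.Icc 1 M, y m
      = q * (x' - x) * (M * (A * h) - (1 - (1 - A * h) ^ M)) / (A * (A * h)) := by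
    rw [eq_div_iff (mul_ne_zero hA hAh), mul_comm, hS]
  simp only [Finset.sum_add_distrib, ← Finset.mul_sum, Finset.sum_const, Nat.card_Icc,
    add_tsub_cancel_right, nsmul_eq_mul]
  rw [eq_add_of_sub_eq hgap]
  have hh' : h ≠ 0 := hh.ne'
  field_simp
  ring
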